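/- Let w_1, ..., w_n be vectors in ℤ² (or ℝ²) summing to zero, ordered so that their directions are sorted by counterclockwise angle from a fixed ray. Then Σ_{i<j} w_i ∧ w_j equals twice the area of the convex polygon whose edges, laid tip-to-tail in order, are w_1, ..., w_n, where ∧ denotes the 2D cross product (a,b) ∧ (c,d) = ad − bc. -/

import Mathlib

open Finset Real MeasureTheory

/-- The 2D cross product `(a,b) ∧ (c,d) = ad − bc`. -/
def cross2 (u v : ℝ × ℝ) : ℝ := u.1 * v.2 - u.2 * v.1

lemma cross2_add_left (a b c : ℝ × ℝ) : cross2 (a + b) c = cross2 a c + cross2 b c := by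
  simp [cross2]; ring

lemma cross2_add_right (a b c : ℝ × ℝ) : cross2 a (b + c) = cross2 a b + cross2 a c := by
  simp [cross2]; ring

lemma cross2_sum_left {ι : Type*} (A : Finset ι) (f : ι → ℝ × ℝ) (c : ℝ × ℝ) :
    cross2 (∑ i ∈ A, f i) c = ∑ i ∈ A, cross2 (f i) c := by
  simp [cross2, Prod.fst_sum, Prod.snd_sum, Finset.sum_mul]

lemma cross2_sum_right {ι : Type*} (A : Finset ι) (f : ι → ℝ × ℝ) (c : ℝ × ℝ) :
    cross2 c (∑ i ∈ A, f i) = ∑ i ∈ A, cross2 c (f i) := by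
  simp [cross2, Prod.fst_sum, Prod.snd_sum, Finset.mul_sum]

lemma cross2_polar (r s a b : ℝ) :
    cross2 (r * cos a, r * sin a) (s * cos b, s * sin b) = r * s * sin (b - a) := by
  simp [cross2, sin_sub]; ring

lemma polar_sum {ι : Type*} (A : Finset ι) (w : ι → ℝ × ℝ) (r θ : ι → ℝ) (hr : ∀ i, 0 < r i)
    (hw : ∀ i, w i = (r i * cos (θ i), r i * sin (θ i))) (s t : ℝ) (hst : s ≤ t)
    (hπ : t - s < π) (h : ∀ l ∈ A, s ≤ θ l ∧ θ l ≤ t) :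
    ∃ ρ γ : ℝ, 0 ≤ ρ ∧ s ≤ γ ∧ γ ≤ t ∧ ∑ l ∈ A, w l = (ρ * cos γ, ρ * sin γ) := by
  set m := (s + t) / 2 with hm
  set d := (t - s) / 2 with hd
  have hd0 : 0 ≤ d := by linarith
  have hd1 : d < π / 2 := by linarith
  have hcd : 0 < cos d := cos_pos_of_mem_Ioo ⟨by linarith, hd1⟩
  -- rotated coordinates
  have key : ∃ x y : ℝ, 0 ≤ x ∧ y ≤ x * tan d ∧ -(x * tan d) ≤ y ∧
      ∑ l ∈ A, w l = (x * cos m - y * sin m, x * sin m + y * cos m) := by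
    refine ⟨∑ l ∈ A, r l * cos (θ l - m), ∑ l ∈ A, r l * sin (θ l - m), ?_, ?_, ?_, ?_⟩
    · refine Finset.sum_nonneg fun l hl => mul_nonneg (hr l).le (cos_nonneg_of_mem_Icc ?_)
      have := h l hl
      constructor <;> linarith
    · rw [Finset.sum_mul]
      refine Finset.sum_le_sum fun l hl => ?_
      rw [mul_assoc]
      refine mul_le_mul_of_nonneg_left ?_ (hr l).le
      have := h l hl
      have h2 : 0 ≤ sin (d - (θ l - m)) := sin_nonneg_of_nonneg_of_le_pi (by linarith) (by linarith)
      rw [sin_sub] at h2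
      rw [tan_eq_sin_div_cos, mul_div_assoc', le_div_iff₀ hcd]
      linarith
    · rw [Finset.sum_mul, ← Finset.sum_neg_distrib]
      refine Finset.sum_le_sum fun l hl => ?_
      rw [mul_assoc, ← mul_neg]
      refine mul_le_mul_of_nonneg_left ?_ (hr l).le
      have := h l hl
      have h2 : 0 ≤ sin (d + (θ l - m)) := sin_nonneg_of_nonneg_of_le_pi (by linarith) (by linarith)
      rw [sin_add] at h2
      rw [tan_eq_sin_div_cos, mul_div_assoc', neg_le, ← neg_le_neg_iff, neg_neg, ← neg_div,
        div_le_iff₀ hcd]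
      linarith
    · simp only [Finset.sum_mul, ← Finset.sum_sub_distrib, ← Finset.sum_add_distrib]
      rw [Prod.ext_iff, Prod.fst_sum, Prod.snd_sum]
      constructor
      · refine Finset.sum_congr rfl fun l _ => ?_
        have : cos (θ l) = cos ((θ l - m) + m) := by ring_nf
        rw [hw l, this, cos_add]; ring
      · refine Finset.sum_congr rfl fun l _ => ?_
        have : sin (θ l) = sin ((θ l - m) + m) := by ring_nf
        rw [hw l, this, sin_add]; ring
  obtain ⟨x, y, hx, hy1, hy2, he⟩ := key
  rcases hx.eq_or_lt with hx | hx
  · have : y = 0 := by subst hx; simp at hy1 hy2; linarith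
    refine ⟨0, s, le_rfl, le_rfl, hst, ?_⟩
    rw [he, ← hx, this]; simp
  · have hc := cos_arctan_pos (y / x)
    have had : arctan (tan d) = d := arctan_tan (by linarith) hd1
    refine ⟨x / cos (arctan (y / x)), m + arctan (y / x), by positivity, ?_, ?_, ?_⟩
    · have : arctan (-tan d) ≤ arctan (y / x) := by
        apply arctan_strictMono.monotone
        rw [le_div_iff₀ hx]; linarith
      rw [arctan_neg, had] at this
      linarith
    · have : arctan (y / x) ≤ arctan (tan d) := by
        apply arctan_strictMono.monotone
        rw [div_le_iff₀ hx]; linarith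
      rw [had] at this
      linarith
    · have ht : sin (arctan (y / x)) = y / x * cos (arctan (y / x)) := by
        have := tan_arctan (y / x)
        rw [tan_eq_sin_div_cos, div_eq_iff hc.ne'] at this
        exact this
      rw [he, cos_add, sin_add, ht, Prod.ext_iff]
      constructor
      · simp only; field_simp
      · simp only; field_simp

section blocks
variable {n : ℕ} (w : Fin n → ℝ × ℝ)

def pV (k : ℕ) : ℝ × ℝ := ∑ i ∈ Finset.univ.filter (fun i : Fin n => (i : ℕ) < k), w i
def pB (i j : ℕ) : ℝ × ℝ :=
  ∑ l ∈ Finset.univ.filter (fun l : Fin n => i ≤ (l : ℕ) ∧ (l : ℕ) < j), w l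

lemma pV_add (i j : ℕ) (h : i ≤ j) : pV w j = pV w i + pB w i j := by
  unfold pV pB
  rw [← Finset.sum_union]
  · congr 1; ext l; simp; omega
  · rw [Finset.disjoint_left]; intro l; simp; omega

lemma pV_n (hsum : ∑ i, w i = 0) : pV w n = 0 := by
  rw [← hsum]; unfold pV; congr 1; ext l; simp

lemma pV_zero : pV w 0 = 0 := by simp [pV]

lemma pV_succ (k : Fin n) : pV w (k + 1) = pV w k + w k := by
  rw [pV_add w k (k+1) (by omega)]
  congr 1
  unfold pB
  rw [Finset.sum_eq_single k]
  · intro b hb hne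
    simp at hb
    exact absurd (Fin.ext (by omega)) hne
  · simp

lemma cross_nonneg' (hsum : ∑ i, w i = 0)
    (r θ : Fin n → ℝ) (hr : ∀ i, 0 < r i)
    (hw : ∀ i, w i = (r i * Real.cos (θ i), r i * Real.sin (θ i)))
    (hmono : Monotone θ)
    (hrange : ∀ i j : Fin n, θ j < θ i + 2 * π)
    (i j : Fin n) (h : 0 ≤ θ j - θ i) (h' : θ j - θ i ≤ π) :
    0 ≤ cross2 (w i) (w j) := by
  rw [hw i, hw j, cross2_polar]
  exact mul_nonneg (mul_pos (hr i) (hr j)).le (sin_nonneg_of_nonneg_of_le_pi h h')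

lemma cross_nonneg_neg (hsum : ∑ i, w i = 0)
    (r θ : Fin n → ℝ) (hr : ∀ i, 0 < r i)
    (hw : ∀ i, w i = (r i * Real.cos (θ i), r i * Real.sin (θ i)))
    (hmono : Monotone θ)
    (hrange : ∀ i j : Fin n, θ j < θ i + 2 * π)
    (i j : Fin n) (h : θ j - θ i ≤ - π) (h' : - (2 * π) ≤ θ j - θ i) :
    0 ≤ cross2 (w i) (w j) := by
  rw [hw i, hw j, cross2_polar]
  refine mul_nonneg (mul_pos (hr i) (hr j)).le ?_
  rw [← sin_add_two_pi]
  exact (sin_nonneg_of_nonneg_of_le_pi (by linarith) (by linarith))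

lemma edge_cond (hsum : ∑ i, w i = 0)
    (r θ : Fin n → ℝ) (hr : ∀ i, 0 < r i)
    (hw : ∀ i, w i = (r i * Real.cos (θ i), r i * Real.sin (θ i)))
    (hmono : Monotone θ)
    (hrange : ∀ i j : Fin n, θ j < θ i + 2 * π)
    (i : ℕ) (m : Fin n) (him : i ≤ m) : 0 ≤ cross2 (pV w m - pV w i) (w m) := by
  rcases him.eq_or_lt with h | him
  · rw [← h]; simp [cross2]
  have e : pV w m - pV w i = pB w i m := by rw [pV_add w i m him.le]; abel
  rw [e]
  set i' : Fin n := ⟨i, by omega⟩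
  by_cases hc : θ m - θ i' ≤ π
  · rw [pB, cross2_sum_left]
    refine Finset.sum_nonneg fun l hl => ?_
    simp at hl
    have h1 : θ i' ≤ θ l := hmono (Fin.le_def.2 hl.1)
    have h2 : θ l ≤ θ m := hmono (Fin.le_def.2 hl.2.le)
    exact cross_nonneg' w hsum r θ hr hw hmono hrange l m (by linarith) (by linarith)
  · push Not at hc
    have e1 := pV_add w i m him.le
    have e2 := pV_add w m n m.2.le
    rw [pV_n w hsum, e1] at e2
    have e3 : cross2 (pB w i m) (w m) = - cross2 (pV w i) (w m) + - cross2 (pB w m n) (w m) := by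
      have : cross2 (pV w i + pB w i m + pB w m n) (w m) = 0 := by rw [← e2]; simp [cross2]
      rw [cross2_add_left, cross2_add_left] at this
      linarith
    have anti : ∀ a b, - cross2 a b = cross2 b a := by intro a b; simp [cross2]; ring
    rw [e3, anti, anti]
    apply add_nonneg
    · rw [pV, cross2_sum_right]
      refine Finset.sum_nonneg fun l hl => ?_
      simp at hl
      have h1 : θ l ≤ θ i' := hmono (Fin.le_def.2 hl.le)
      have := hrange l m
      exact cross_nonneg_neg w hsum r θ hr hw hmono hrange m l (by linarith) (by linarith)
    · rw [pB, cross2_sum_right]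
      refine Finset.sum_nonneg fun l hl => ?_
      simp at hl
      have h1 : θ m ≤ θ l := hmono (Fin.le_def.2 hl)
      have := hrange i' l
      exact cross_nonneg' w hsum r θ hr hw hmono hrange m l (by linarith) (by linarith)

lemma fan_cond (hsum : ∑ i, w i = 0)
    (r θ : Fin n → ℝ) (hr : ∀ i, 0 < r i)
    (hw : ∀ i, w i = (r i * Real.cos (θ i), r i * Real.sin (θ i)))
    (hmono : Monotone θ)
    (hrange : ∀ i j : Fin n, θ j < θ i + 2 * π)
    (i j : ℕ) (hij : i ≤ j) (hj : j ≤ n) : 0 ≤ cross2 (pV w i) (pV w j) := by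
  rcases Nat.eq_zero_or_pos i with h | hi
  · rw [h, pV_zero]; simp [cross2]
  rcases hij.eq_or_lt with h | hij
  · rw [h]; simp [cross2, mul_comm]
  rcases hj.eq_or_lt with h | hj
  · rw [h, pV_n w hsum]; simp [cross2]
  have e1 := pV_add w i j hij.le
  have e2 := pV_add w j n hj.le
  rw [pV_n w hsum, e1] at e2
  rw [e1]
  have ea : pV w i = pB w 0 i := by simp [pV, pB]
  rw [ea] at e2 ⊢
  set a := pB w 0 i with ha
  set b := pB w i j with hb
  set c := pB w j n with hc'
  have hab : cross2 a (a + b) = cross2 a b := by simp [cross2]; ring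
  have hc : c = -(a + b) := by rw [eq_neg_iff_add_eq_zero, e2]; abel
  have hbc : cross2 b c = cross2 a b := by rw [hc]; simp [cross2]; ring
  have hca : cross2 c a = cross2 a b := by rw [hc]; simp [cross2]; ring
  rw [hab]
  have mem : ∀ p q : ℕ, ∀ l ∈ Finset.univ.filter (fun l : Fin n => p ≤ (l : ℕ) ∧ (l : ℕ) < q),
      p ≤ (l : ℕ) ∧ (l : ℕ) < q := by intro p q l; simp
  have mono' : ∀ p q (hp : p < n) (hq : q < n), p ≤ q → θ ⟨p, hp⟩ ≤ θ ⟨q, hq⟩ :=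
    fun p q hp hq h => hmono (Fin.le_def.2 h)
  have o1 := mono' 0 (i-1) (by omega) (by omega) (by omega)
  have o2 := mono' (i-1) i (by omega) (by omega) (by omega)
  have o3 := mono' i (j-1) (by omega) (by omega) (by omega)
  have o4 := mono' (j-1) j (by omega) (by omega) (by omega)
  have o5 := mono' j (n-1) (by omega) (by omega) (by omega)
  have o6 := hrange ⟨0, by omega⟩ ⟨n-1, by omega⟩
  have bd : ∀ p q (hp : p < n) (hq : q - 1 < n), ∀ l ∈ Finset.univ.filter
      (fun l : Fin n => p ≤ (l : ℕ) ∧ (l : ℕ) < q), θ ⟨p, hp⟩ ≤ θ l ∧ θ l ≤ θ ⟨q-1, hq⟩ := by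
    intro p q hp hq l hl
    have := mem p q l hl
    exact ⟨hmono (Fin.le_def.2 this.1), hmono (Fin.le_def.2 (by simp; omega))⟩
  have bA := bd 0 i (by omega) (by omega)
  have bB := bd i j (by omega) (by omega)
  have bC := bd j n (by omega) (by omega)
  by_cases cA : π ≤ θ ⟨i-1, by omega⟩ - θ ⟨0, by omega⟩
  · rw [← hbc, hb, hc', pB, pB, cross2_sum_left]
    refine Finset.sum_nonneg fun l hl => ?_
    rw [cross2_sum_right]
    refine Finset.sum_nonneg fun m hm => ?_
    have h1 := bB l hl
    have h2 := bC m hm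
    exact cross_nonneg' w hsum r θ hr hw hmono hrange l m (by linarith) (by linarith)
  by_cases cB : π ≤ θ ⟨j-1, by omega⟩ - θ ⟨i, by omega⟩
  · rw [← hca, ha, hc', pB, pB, cross2_sum_left]
    refine Finset.sum_nonneg fun l hl => ?_
    rw [cross2_sum_right]
    refine Finset.sum_nonneg fun m hm => ?_
    have h1 := bC l hl
    have h2 := bA m hm
    exact cross_nonneg_neg w hsum r θ hr hw hmono hrange l m (by linarith) (by linarith)
  by_cases cC : π ≤ θ ⟨n-1, by omega⟩ - θ ⟨j, by omega⟩
  · rw [ha, hb, pB, pB, cross2_sum_left]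
    refine Finset.sum_nonneg fun l hl => ?_
    rw [cross2_sum_right]
    refine Finset.sum_nonneg fun m hm => ?_
    have h1 := bA l hl
    have h2 := bB m hm
    exact cross_nonneg' w hsum r θ hr hw hmono hrange l m (by linarith) (by linarith)
  push Not at cA cB cC
  obtain ⟨ra, α, hra, a1, a2, ae⟩ := polar_sum _ w r θ hr hw _ _ o1 cA bA
  obtain ⟨rb, β, hrb, b1, b2, be⟩ := polar_sum _ w r θ hr hw _ _ o3 cB bB
  obtain ⟨rc, γ, hrc, c1, c2, ce⟩ := polar_sum _ w r θ hr hw _ _ o5 cC bC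
  change a = _ at ae
  change b = _ at be
  change c = _ at ce
  by_contra! hneg
  have n1 := hneg
  have n2 := hneg
  rw [ae, be, cross2_polar] at n1
  rw [← hbc, be, ce, cross2_polar] at n2
  have g1 : π < β - α := by
    by_contra! hh
    have := mul_nonneg (mul_nonneg hra hrb)
      (sin_nonneg_of_nonneg_of_le_pi (x := β - α) (by linarith) hh)
    linarith
  have g2 : π < γ - β := by
    by_contra! hh
    have := mul_nonneg (mul_nonneg hrb hrc)
      (sin_nonneg_of_nonneg_of_le_pi (x := γ - β) (by linarith) hh)
    linarith
  linarith

end blocks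

def stdTri : Set (ℝ × ℝ) := {x | 0 ≤ x.1 ∧ 0 ≤ x.2 ∧ x.1 + x.2 ≤ 1}

lemma stdTri_closed : IsClosed stdTri := by
  have h1 : IsClosed {x : ℝ × ℝ | 0 ≤ x.1} := isClosed_le continuous_const continuous_fst
  have h2 : IsClosed {x : ℝ × ℝ | 0 ≤ x.2} := isClosed_le continuous_const continuous_snd
  have h3 : IsClosed {x : ℝ × ℝ | x.1 + x.2 ≤ 1} :=
    isClosed_le (continuous_fst.add continuous_snd) continuous_const
  exact h1.inter (h2.inter h3)

lemma stdTri_volume : volume stdTri = ENNReal.ofReal (1 / 2) := by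
  rw [Measure.volume_eq_prod, Measure.prod_apply stdTri_closed.measurableSet]
  have : ∀ x : ℝ, volume (Prod.mk x ⁻¹' stdTri) =
      (Set.Icc (0:ℝ) 1).indicator (fun x => ENNReal.ofReal (1 - x)) x := by
    intro x
    by_cases hx : x ∈ Set.Icc (0:ℝ) 1
    · rw [Set.indicator_of_mem hx]
      have : Prod.mk x ⁻¹' stdTri = Set.Icc 0 (1 - x) := by
        ext y; simp [stdTri]; 
        exact ⟨fun h => ⟨h.2.1, by linarith⟩, fun h => ⟨hx.1, h.1, by linarith⟩⟩
      rw [this, Real.volume_Icc, sub_zero]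
    · rw [Set.indicator_of_notMem hx]
      have : Prod.mk x ⁻¹' stdTri = ∅ := by
        ext y; simp [stdTri]
        intro h h'
        by_contra! h2
        exact hx ⟨h, by linarith⟩
      rw [this, measure_empty]
  simp_rw [this]
  rw [lintegral_indicator measurableSet_Icc, ← ofReal_integral_eq_lintegral_ofReal]
  · congr 1
    rw [integral_Icc_eq_integral_Ioc, ← intervalIntegral.integral_of_le zero_le_one]
    rw [intervalIntegral.integral_sub (by simp) (by simp)]
    simp; norm_num
  · exact (by fun_prop : Continuous fun x : ℝ => 1 - x).continuousOn.integrableOn_Icc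
  · filter_upwards [ae_restrict_mem measurableSet_Icc] with x hx
    simpa using hx.2

noncomputable def triMap (p q : ℝ × ℝ) : (ℝ × ℝ) →ₗ[ℝ] (ℝ × ℝ) :=
  (LinearMap.fst ℝ ℝ ℝ).smulRight p + (LinearMap.snd ℝ ℝ ℝ).smulRight q

lemma triMap_apply (p q x : ℝ × ℝ) : triMap p q x = x.1 • p + x.2 • q := by simp [triMap]

lemma triMap_det (p q : ℝ × ℝ) : LinearMap.det (triMap p q) = cross2 p q := by
  rw [← LinearMap.det_toMatrix (Module.Basis.finTwoProd ℝ), Matrix.det_fin_two]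
  simp [LinearMap.toMatrix_apply, triMap_apply, cross2]
  ring

lemma tri_volume (p q : ℝ × ℝ) :
    volume (triMap p q '' stdTri) = ENNReal.ofReal (|cross2 p q| / 2) := by
  rw [Measure.addHaar_image_linearMap, triMap_det, stdTri_volume,
    ← ENNReal.ofReal_mul (abs_nonneg _)]
  congr 1; ring

lemma line_null (q : ℝ × ℝ) (hq : q ≠ 0) : volume {x : ℝ × ℝ | cross2 x q = 0} = 0 := by
  let f : (ℝ × ℝ) →ₗ[ℝ] ℝ := q.2 • LinearMap.fst ℝ ℝ ℝ - q.1 • LinearMap.snd ℝ ℝ ℝ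
  have hf : ∀ x, f x = cross2 x q := by intro x; simp [f, cross2]; ring
  have : {x : ℝ × ℝ | cross2 x q = 0} = (LinearMap.ker f : Set (ℝ × ℝ)) := by
    ext x; simp [hf]
  rw [this]
  apply Measure.addHaar_submodule
  intro h
  rw [LinearMap.ker_eq_top] at h
  apply hq
  have h1 := hf (1, 0)
  have h2 := hf (0, 1)
  rw [h] at h1 h2
  simp [cross2] at h1 h2
  exact Prod.ext h2 h1.symm

lemma hull_half {S : Set (ℝ × ℝ)} (a b c : ℝ) (h : ∀ x ∈ S, 0 ≤ a * x.1 + b * x.2 + c) :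
    ∀ x ∈ convexHull ℝ S, 0 ≤ a * x.1 + b * x.2 + c := by
  have hc : Convex ℝ {x : ℝ × ℝ | 0 ≤ a * x.1 + b * x.2 + c} := by
    intro x hx y hy s t hs ht hst
    simp only [Set.mem_ofPred_eq, Prod.fst_add, Prod.snd_add, Prod.smul_fst, Prod.smul_snd,
      smul_eq_mul] at *
    have : t = 1 - s := by linarith
    have := add_nonneg (mul_nonneg hs hx) (mul_nonneg ht hy)
    have e : c = (s + t) * c := by rw [hst, one_mul]
    rw [e]; linarith
  exact convexHull_min h hc

lemma fan_step (S : Set (ℝ × ℝ)) (hS : S.Finite) (p q : ℝ × ℝ) (h0 : (0 : ℝ × ℝ) ∈ S) (hp : p ∈ S)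
    (h1 : ∀ x ∈ S, 0 ≤ cross2 x p) (h2 : ∀ x ∈ S, 0 ≤ cross2 x q)
    (h3 : ∀ x ∈ S, 0 ≤ cross2 (p - x) (q - p)) :
    volume (convexHull ℝ (insert q S)) =
      volume (convexHull ℝ S) + ENNReal.ofReal (cross2 p q / 2) := by
  have D0 := h2 p hp
  rcases D0.eq_or_lt with D | D
  · rw [← D]
    simp only [zero_div, ENNReal.ofReal_zero, add_zero]
    by_cases hq : q = 0
    · rw [hq, Set.insert_eq_of_mem h0]
    obtain ⟨l, hl⟩ : ∃ l : ℝ, p = l • q := by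
      simp only [cross2] at D
      by_cases hq1 : q.1 = 0
      · have hq2 : q.2 ≠ 0 := fun h => hq (Prod.ext hq1 h)
        refine ⟨p.2 / q.2, Prod.ext ?_ ?_⟩
        · rw [hq1] at D
          simp [hq1]
          have : p.1 * q.2 = 0 := by linarith
          simpa [hq2] using this
        · simp [hq2]
      · refine ⟨p.1 / q.1, Prod.ext ?_ ?_⟩
        · simp [hq1]
        · simp; field_simp; linarith
    by_cases h1l : 1 ≤ l
    · have : q ∈ convexHull ℝ S := by
        have hl0 : 0 < l := by linarith
        have := (convex_convexHull ℝ S) (subset_convexHull ℝ S h0) (subset_convexHull ℝ S hp)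
          (a := 1 - 1 / l) (b := 1 / l)
          (by rw [sub_nonneg, div_le_one hl0]; exact h1l) (by positivity) (by ring)
        rw [hl, smul_zero, zero_add, smul_smul, one_div_mul_cancel hl0.ne', one_smul] at this
        exact this
      congr 1
      apply Set.Subset.antisymm
      · exact convexHull_min (Set.insert_subset this (subset_convexHull ℝ S)) (convex_convexHull ℝ S)
      · exact convexHull_mono (Set.subset_insert _ _)
    · push Not at h1l
      have hx : ∀ x ∈ S, cross2 x q = 0 := by
        intro x hx
        have a2 := h2 x hx
        have a3 := h3 x hx
        rw [hl] at a3
        have : cross2 (l • q - x) (q - l • q) = (l - 1) * cross2 x q := by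
          simp [cross2]; ring
        rw [this] at a3
        nlinarith
      have hsub : convexHull ℝ (insert q S) ⊆ {x : ℝ × ℝ | cross2 x q = 0} := by
        apply convexHull_min
        · apply Set.insert_subset
          · simp [cross2, mul_comm]
          · exact hx
        · intro x hx y hy s t hs ht hst
          simp only [Set.mem_ofPred_eq, cross2, Prod.fst_add, Prod.snd_add, Prod.smul_fst,
            Prod.smul_snd, smul_eq_mul] at *
          linear_combination s * hx + t * hy
      have z := measure_mono_null hsub (line_null q hq)
      rw [z, measure_mono_null (convexHull_mono (Set.subset_insert q S)) z]
  · have H1 : ∀ x ∈ convexHull ℝ S, 0 ≤ cross2 x p := by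
      intro x hx
      have := hull_half (S := S) p.2 (-p.1) 0 (fun x hx => by
        have := h1 x hx; simp only [cross2] at this; linarith) x hx
      simp only [cross2]; linarith
    have H2 : ∀ x ∈ convexHull ℝ S, 0 ≤ cross2 x q := by
      intro x hx
      have := hull_half (S := S) q.2 (-q.1) 0 (fun x hx => by
        have := h2 x hx; simp only [cross2] at this; linarith) x hx
      simp only [cross2]; linarith
    have H3 : ∀ x ∈ convexHull ℝ S, cross2 x q ≤ cross2 p q + cross2 x p := by
      intro x hx
      have := hull_half (S := S) (p.2 - q.2) (q.1 - p.1) (cross2 p q) (fun x hx => by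
        have := h3 x hx; simp only [cross2, Prod.fst_sub, Prod.snd_sub] at this ⊢; linarith) x hx
      simp only [cross2] at this ⊢; linarith
    have hp0 : p ≠ 0 := by rintro rfl; simp [cross2] at D
    have hun : convexHull ℝ (insert q S) = convexHull ℝ S ∪ triMap p q '' stdTri := by
      apply Set.Subset.antisymm
      · rw [convexHull_insert ⟨0, h0⟩]
        intro z hz
        rw [mem_convexJoin] at hz
        obtain ⟨q', hq', x, hx, s, t, hs, ht, hst, rfl⟩ := hz
        rw [Set.mem_singleton_iff] at hq'
        subst q'
        have a1 := H1 x hx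
        have a2 := H2 x hx
        have a3 := H3 x hx
        set d := cross2 p q with hd
        obtain ⟨b, hb⟩ : ∃ b, b = cross2 x q / d := ⟨_, rfl⟩
        obtain ⟨c, hc⟩ : ∃ c, c = cross2 x p / d := ⟨_, rfl⟩
        have hb0 : 0 ≤ b := by rw [hb]; positivity
        have hc0 : 0 ≤ c := by rw [hc]; positivity
        have hbc : b ≤ 1 + c := by
          rw [hb, hc, div_le_iff₀ D, add_mul, div_mul_cancel₀ _ D.ne']; linarith
        have hxe : x = b • p - c • q := by
          have hd' : d ≠ 0 := D.ne'
          rw [hb, hc]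
          apply Prod.ext
          · simp only [Prod.fst_sub, Prod.smul_fst, smul_eq_mul]
            field_simp
            rw [hd]; simp only [cross2]; ring
          · simp only [Prod.snd_sub, Prod.smul_snd, smul_eq_mul]
            field_simp
            rw [hd]; simp only [cross2]; ring
        by_cases hcase : t * c ≤ s
        · right
          refine ⟨(t * b, s - t * c), ⟨by positivity, by simpa using hcase, ?_⟩, ?_⟩
          · simp only; nlinarith
          · rw [triMap_apply, hxe]; module
        · left
          push Not at hcase
          have hcpos : 0 < c := by
            rcases hc0.eq_or_lt with h | h
            · rw [← h] at hcase; linarith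
            · exact h
          have hy : (b / (1 + c)) • p ∈ convexHull ℝ S := by
            have := (convex_convexHull ℝ S) (subset_convexHull ℝ S h0) (subset_convexHull ℝ S hp)
              (a := 1 - b / (1 + c)) (b := b / (1 + c))
              (by rw [sub_nonneg, div_le_one (by positivity)]; exact hbc) (by positivity) (by ring)
            simpa using this
          have := (convex_convexHull ℝ S) hx hy (a := (t * c - s) / c) (b := s * (1 + c) / c)
            (div_nonneg (by linarith) hc0) (by positivity)
            (by field_simp; linear_combination c * hst)
          convert this using 1
          rw [hxe, smul_smul]
          have e1 : s * (1 + c) / c * (b / (1 + c)) = s * b / c := by field_simp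
          rw [e1]
          apply Prod.ext
          · simp; field_simp; ring
          · simp; field_simp; ring
      · apply Set.union_subset (convexHull_mono (Set.subset_insert _ _))
        rintro _ ⟨⟨u, v⟩, ⟨hu, hv, huv⟩, rfl⟩
        simp only at hu hv huv
        have m0 : (0 : ℝ × ℝ) ∈ convexHull ℝ (insert q S) :=
          subset_convexHull ℝ _ (Set.mem_insert_of_mem _ h0)
        have mp : p ∈ convexHull ℝ (insert q S) :=
          subset_convexHull ℝ _ (Set.mem_insert_of_mem _ hp)
        have mq : q ∈ convexHull ℝ (insert q S) := subset_convexHull ℝ _ (Set.mem_insert _ _)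
        have := (convex_convexHull ℝ (insert q S)).sum_mem (t := Finset.univ)
          (w := ![1 - u - v, u, v]) (z := ![0, p, q])
          (by intro i _; fin_cases i <;> simp <;> linarith)
          (by simp [Fin.sum_univ_three]; ring)
          (by intro i _; fin_cases i <;> simp [m0, mp, mq])
        simpa [Fin.sum_univ_three, triMap_apply] using this
    have hTm : MeasurableSet (triMap p q '' stdTri) := by
      have hcomp : IsCompact stdTri := by
        refine (isCompact_Icc (a := ((0, 0) : ℝ × ℝ)) (b := (1, 1))).of_isClosed_subset
          stdTri_closed ?_
        rintro ⟨x, y⟩ ⟨a, b, c⟩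
        simp only at a b c
        exact ⟨⟨a, b⟩, ⟨by simp; linarith, by simp; linarith⟩⟩
      exact (hcomp.image (LinearMap.continuous_of_finiteDimensional _)).measurableSet
    have hdis : AEDisjoint volume (convexHull ℝ S) (triMap p q '' stdTri) := by
      refine measure_mono_null ?_ (line_null p hp0)
      rintro x ⟨hx, ⟨⟨u, v⟩, ⟨hu, hv, huv⟩, rfl⟩⟩
      have := H1 _ hx
      rw [triMap_apply] at this ⊢
      simp only at hv
      have e : cross2 (u • p + v • q) p = - (v * cross2 p q) := by simp [cross2]; ring
      simp only [Set.mem_ofPred_eq]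
      rw [e] at this ⊢
      have := mul_nonneg hv D.le
      linarith
    rw [hun, measure_union₀ hTm.nullMeasurableSet hdis, tri_volume, abs_of_pos D]

lemma fan_volume (N : ℕ) (P : ℕ → ℝ × ℝ) (P0 : P 0 = 0)
    (hf : ∀ i j, i ≤ j → j ≤ N → 0 ≤ cross2 (P i) (P j))
    (he : ∀ i m, i ≤ m → m < N → 0 ≤ cross2 (P m - P i) (P (m + 1) - P m)) :
    ∀ m ≤ N, volume (convexHull ℝ (P '' {k | k ≤ m})) =
      ENNReal.ofReal ((∑ k ∈ Finset.range m, cross2 (P k) (P (k + 1))) / 2) := by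
  intro m
  induction m with
  | zero => intro _; simp
  | succ m ih =>
    intro hm
    have e : P '' {k | k ≤ m + 1} = insert (P (m + 1)) (P '' {k | k ≤ m}) := by
      rw [← Set.image_insert_eq]
      congr 1; ext k; simp; omega
    rw [e, fan_step _ ((Set.finite_le_nat m).image P) (P m) (P (m + 1)) ⟨0, by simp, P0⟩
      ⟨m, by simp, rfl⟩, ih (by omega), ← ENNReal.ofReal_add, Finset.sum_range_succ]
    · congr 1; ring
    · refine div_nonneg (Finset.sum_nonneg fun k hk => hf _ _ (by omega) ?_) (by norm_num)
      rw [Finset.mem_range] at hk; omega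
    · exact div_nonneg (hf _ _ (by omega) hm) (by norm_num)
    · rintro _ ⟨k, hk, rfl⟩
      exact hf _ _ hk (by omega)
    · rintro _ ⟨k, hk, rfl⟩
      exact hf _ _ (le_trans hk (by omega)) hm
    · rintro _ ⟨k, hk, rfl⟩
      exact he _ _ hk (by omega)

/-- If vectors `w_1,...,w_n` in the plane sum to zero and are sorted by
counterclockwise angle from a fixed ray (angles `θ i` strictly within one full turn,
monotone), then `Σ_{i<j} w_i ∧ w_j` equals twice the area of the convex polygon whose
edges, laid tip-to-tail in order, are `w_1,...,w_n`. -/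
theorem stmt2 {n : ℕ} (w : Fin n → ℝ × ℝ)
    (hsum : ∑ i, w i = 0)
    (r θ : Fin n → ℝ) (hr : ∀ i, 0 < r i)
    (hw : ∀ i, w i = (r i * Real.cos (θ i), r i * Real.sin (θ i)))
    (hmono : Monotone θ)
    (hrange : ∀ i j : Fin n, θ j < θ i + 2 * π) :
    (∑ i, ∑ j ∈ Finset.univ.filter (fun j => i < j), cross2 (w i) (w j)) =
      2 * (volume (convexHull ℝ
        (Set.range (fun k : Fin (n + 1) =>
          ∑ i ∈ Finset.univ.filter (fun i : Fin n => (i : ℕ) < (k : ℕ)), w i)))).toReal := by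
  have hV := fan_volume n (pV w) (pV_zero w)
    (fun i j => fan_cond w hsum r θ hr hw hmono hrange i j)
    (fun i m him hm => by
      have := edge_cond w hsum r θ hr hw hmono hrange i ⟨m, hm⟩ him
      have e := pV_succ w ⟨m, hm⟩
      simp only at e this
      rw [e, add_sub_cancel_left]
      exact this) n le_rfl
  have hset : (Set.range (fun k : Fin (n + 1) =>
          ∑ i ∈ Finset.univ.filter (fun i : Fin n => (i : ℕ) < (k : ℕ)), w i)) =
      pV w '' {k | k ≤ n} := by
    ext x
    constructor
    · rintro ⟨k, rfl⟩
      exact ⟨k, Nat.lt_succ_iff.1 k.2, rfl⟩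
    · rintro ⟨k, hk, rfl⟩
      exact ⟨⟨k, Nat.lt_succ_iff.2 hk⟩, rfl⟩
  rw [hset, hV, ENNReal.toReal_ofReal]
  · rw [mul_div_cancel₀ _ (two_ne_zero), ← Fin.sum_univ_eq_sum_range
      (fun k => cross2 (pV w k) (pV w (k + 1)))]
    simp_rw [Finset.sum_filter]
    rw [Finset.sum_comm]
    refine Finset.sum_congr rfl fun k _ => ?_
    rw [pV_succ, cross2_add_right, ← Finset.sum_filter]
    have : cross2 (pV w k) (pV w k) = 0 := by simp [cross2, mul_comm]
    rw [this, zero_add, pV, cross2_sum_left]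
    rfl
  · refine div_nonneg (Finset.sum_nonneg fun k hk => ?_) (by norm_num)
    rw [Finset.mem_range] at hk
    exact fan_cond w hsum r θ hr hw hmono hrange _ _ (by omega) (by omega)
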